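/- Let q be a prime power, m ≥ 1, Q a nonsingular quadratic form on V = F_q^{2m} with polar form B, and ε ∈ {1,−1} such that ∑_{x∈V} ψ_1(αQ(x)) = ε q^m for every α ∈ F_q^×. Then for every b ∈ V with b ≠ 0: ∑_{x∈V, Q(x)=0} ψ_1(B(b,x)) = ε q^{m−1}(q−1) if Q(b) = 0, and ∑_{x∈V, Q(x)=0} ψ_1(B(b,x)) = −ε q^{m−1} if Q(b) ≠ 0. -/

import Mathlib

open Finset

noncomputable section
open scoped Classical

/-- `D` is a `(v,k,λ,μ)` partial difference set in the finite abelian group `G`: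
every nonzero element of `D` is a difference of elements of `D` in exactly `λ` ways,
and every nonzero element outside `D` in exactly `μ` ways. -/
def IsPDS {G : Type*} [AddCommGroup G] [Fintype G] (D : Finset G) (v k lam mu : ℤ) : Prop :=
  (Fintype.card G : ℤ) = v ∧ (D.card : ℤ) = k ∧
    ∀ g : G, g ≠ 0 →
      ((((D ×ˢ D).filter fun xy => xy.1 - xy.2 = g).card : ℤ) = if g ∈ D then lam else mu)

noncomputable instance (p n : ℕ) [Fact p.Prime] : Fintype (GaloisField p n) :=
  Fintype.ofFinite _

/-- The canonical additive character `ψ₁(x) = ω_p^{Tr(x)}` of `F_{p^n}`,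
where `ω_p = exp(2πi/p)` and `Tr` is the absolute trace. -/
def psi (p n : ℕ) [Fact p.Prime] (x : GaloisField p n) : ℂ :=
  Complex.exp (2 * Real.pi * Complex.I *
    ((Algebra.trace (ZMod p) (GaloisField p n) x).val : ℂ) / p)

/-- The cyclotomic class `C_i = {g^{i+ej} : 0 ≤ j ≤ f-1}` of order `e`
with respect to the primitive element `g`. -/
def cycClass (p n : ℕ) [Fact p.Prime] (g : GaloisField p n) (e f i : ℕ) :
    Finset (GaloisField p n) :=
  (Finset.range f).image fun j => g ^ (i + e * j)

/-- The polar form `B(x,y) = Q(x+y) − Q(x) − Q(y)` of `Q`. -/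
def polarForm {F V : Type*} [Field F] [AddCommGroup V] (Q : V → F) (x y : V) : F :=
  Q (x + y) - Q x - Q y

/-- The canonical additive character `psi p n` as an `AddChar`. -/
def psiAddChar (p n : ℕ) [Fact p.Prime] : AddChar (GaloisField p n) ℂ :=
  (ZMod.stdAddChar (N := p)).compAddMonoidHom
    (Algebra.trace (ZMod p) (GaloisField p n)).toAddMonoidHom

lemma psiAddChar_apply (p n : ℕ) [Fact p.Prime] (x : GaloisField p n) :
    psiAddChar p n x = psi p n x := by
  change ZMod.stdAddChar (Algebra.trace (ZMod p) (GaloisField p n) x) = _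
  rw [ZMod.stdAddChar_apply, ZMod.toCircle_apply, psi]

lemma psiAddChar_isPrimitive (p n : ℕ) [Fact p.Prime] : (psiAddChar p n).IsPrimitive := by
  apply AddChar.IsPrimitive.of_ne_one
  obtain ⟨x, hx⟩ := Algebra.trace_surjective (ZMod p) (GaloisField p n) 1
  refine AddChar.ne_one_iff.mpr ⟨x, fun h => ?_⟩
  change ZMod.stdAddChar (Algebra.trace (ZMod p) (GaloisField p n) x) = 1 at h
  rw [hx, ← AddChar.map_zero_eq_one (ZMod.stdAddChar (N := p))] at h
  exact one_ne_zero (ZMod.injective_stdAddChar h)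

section CharacterSums

variable {F V : Type*} [Field F] {ψ : AddChar F ℂ}

lemma polarForm_comm [AddCommGroup V] (Q : V → F) (x y : V) : polarForm Q x y = polarForm Q y x :=
  QuadraticMap.polar_comm Q x y

/-- Multiplying a complex character sum over the fibre `f = 0` by `#F` expands it over all
additive characters of the field `F`. -/
lemma card_mul_sum_filter_eq_zero [Fintype F] [Fintype V] (hψ : ψ.IsPrimitive)
    (f : V → F) (g : V → ℂ) :
    (Fintype.card F : ℂ) * ∑ x with f x = 0, g x = ∑ α, ∑ x, ψ (α * f x) * g x := by
  rw [Finset.sum_comm, Finset.mul_sum, Finset.sum_filter]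
  refine Finset.sum_congr rfl fun x _ => ?_
  rw [← Finset.sum_mul, AddChar.sum_mulShift (f x) hψ]
  split_ifs <;> simp

/-- A primitive additive character, evaluated at `-(α⁻¹ * c)` and summed over nonzero `α`. -/
lemma sum_ne_zero_inv_mul [Fintype F] (hψ : ψ.IsPrimitive) (c : F) :
    ∑ α : F with α ≠ 0, ψ (-(α⁻¹ * c)) = if c = 0 then (Fintype.card F : ℂ) - 1 else -1 := by
  have h : ∑ α : F, ψ (-(α⁻¹ * c)) = if c = 0 then (Fintype.card F : ℂ) else 0 := by
    rw [← Equiv.sum_comp ((Equiv.inv F).trans (Equiv.neg F))]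
    simpa [inv_neg] using AddChar.sum_mulShift c hψ
  rw [Finset.filter_ne', Finset.sum_erase_eq_sub (Finset.mem_univ _), h]
  split_ifs <;> simp

/-- Completing the square: `α Q(x) + B(b, x) = α Q(x + α⁻¹ b) - α⁻¹ Q(b)`. -/
lemma sum_mul_add_polarForm [AddCommGroup V] [Module F V] [Fintype V] {Q : V → F}
    (hQ : ∀ (a : F) x, Q (a • x) = a ^ 2 * Q x)
    (hBsmul : ∀ (a : F) x y, polarForm Q (a • x) y = a * polarForm Q x y)
    (b : V) {α : F} (hα : α ≠ 0) :
    ∑ x, ψ (α * Q x) * ψ (polarForm Q b x) = ψ (-(α⁻¹ * Q b)) * ∑ x, ψ (α * Q x) := by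
  rw [← Equiv.sum_comp (Equiv.addRight (α⁻¹ • b)) (fun x => ψ (α * Q x)), Finset.mul_sum]
  refine Finset.sum_congr rfl fun x _ => ?_
  have h : Q (x + α⁻¹ • b) = Q x + (α⁻¹) ^ 2 * Q b + α⁻¹ * polarForm Q b x := by
    rw [← hQ, ← hBsmul, polarForm_comm, polarForm]
    ring
  rw [Equiv.coe_addRight, h, ← AddChar.map_add_eq_mul, ← AddChar.map_add_eq_mul]
  congr 1
  field_simp
  ring

lemma sum_polarForm_eq_zero [AddCommGroup V] [Module F V] [Fintype V] {Q : V → F}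
    (hψ : ψ.IsPrimitive)
    (hBadd : ∀ x y z, polarForm Q (x + y) z = polarForm Q x z + polarForm Q y z)
    (hBsmul : ∀ (a : F) x y, polarForm Q (a • x) y = a * polarForm Q x y)
    {b : V} (hb : ∃ y, polarForm Q b y ≠ 0) :
    ∑ x, ψ (polarForm Q b x) = 0 := by
  let B : V →+ F := AddMonoidHom.mk' (polarForm Q b) fun x y => by
    simp only [polarForm_comm Q b, hBadd]
  change ∑ x, ψ.compAddMonoidHom B x = 0
  refine AddChar.sum_eq_zero_of_ne_one (AddChar.ne_one_iff.mpr ?_)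
  obtain ⟨y, hy⟩ := hb
  obtain ⟨c, hc⟩ := AddChar.ne_one_iff.mp (hψ hy)
  refine ⟨c • y, ?_⟩
  change ψ (polarForm Q b (c • y)) ≠ 1
  rwa [polarForm_comm, hBsmul, polarForm_comm, mul_comm]

/-- If all the sums `∑ ψ(α Q(x))`, `α ≠ 0`, have the same value `G`, then the character sum of
`B(b, ·)` over the quadric `Q = 0` is determined by `G` and whether `Q(b)` vanishes. -/
lemma card_mul_sum_quadric [Fintype F] [AddCommGroup V] [Module F V] [Fintype V] {Q : V → F}
    (hψ : ψ.IsPrimitive)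
    (hQ : ∀ (a : F) x, Q (a • x) = a ^ 2 * Q x)
    (hBadd : ∀ x y z, polarForm Q (x + y) z = polarForm Q x z + polarForm Q y z)
    (hBsmul : ∀ (a : F) x y, polarForm Q (a • x) y = a * polarForm Q x y)
    {G : ℂ} (hG : ∀ α : F, α ≠ 0 → ∑ x, ψ (α * Q x) = G)
    {b : V} (hb : ∃ y, polarForm Q b y ≠ 0) :
    (Fintype.card F : ℂ) * ∑ x with Q x = 0, ψ (polarForm Q b x) =
      (if Q b = 0 then (Fintype.card F : ℂ) - 1 else -1) * G := by
  rw [card_mul_sum_filter_eq_zero hψ, ← sum_ne_zero_inv_mul hψ, Finset.sum_mul,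
    ← Finset.sum_filter_add_sum_filter_not Finset.univ (fun α : F => α ≠ 0)]
  have h0 : ∑ α : F with ¬α ≠ 0, ∑ x, ψ (α * Q x) * ψ (polarForm Q b x) = 0 := by
    refine Finset.sum_eq_zero fun α hα => ?_
    obtain rfl : α = 0 := by simpa using hα
    simpa using sum_polarForm_eq_zero hψ hBadd hBsmul hb
  rw [h0, add_zero]
  refine Finset.sum_congr rfl fun α hα => ?_
  have hα : α ≠ 0 := by simpa using hα
  rw [sum_mul_add_polarForm hQ hBsmul b hα, hG α hα]

end CharacterSums

/-- Let `Q` be a nonsingular quadratic form on `V = F_q^{2m}` of type `ε`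
(`∑_{x∈V} ψ₁(αQ(x)) = ε q^m` for all `α ≠ 0`).  Then for every `b ≠ 0`,
`∑_{x : Q(x)=0} ψ₁(B(b,x))` equals `ε q^{m−1}(q−1)` if `Q(b) = 0` and `−ε q^{m−1}` otherwise. -/
theorem character_sum_over_quadric
    (p s : ℕ) [Fact p.Prime] (hs : 0 < s) (m : ℕ) (hm : 1 ≤ m)
    (Q : (Fin (2 * m) → GaloisField p s) → GaloisField p s)
    (hQ : ∀ (a : GaloisField p s) x, Q (a • x) = a ^ 2 * Q x)
    (hBadd : ∀ x y z, polarForm Q (x + y) z = polarForm Q x z + polarForm Q y z)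
    (hBsmul : ∀ (a : GaloisField p s) x y, polarForm Q (a • x) y = a * polarForm Q x y)
    (hBnd : ∀ x, (∀ y, polarForm Q x y = 0) → x = 0)
    (ε : ℤ) (hε : ε = 1 ∨ ε = -1)
    (hsum : ∀ α : GaloisField p s, α ≠ 0 →
      ∑ x : Fin (2 * m) → GaloisField p s, psi p s (α * Q x)
        = (ε : ℂ) * ((p : ℂ) ^ s) ^ m) :
    ∀ b : Fin (2 * m) → GaloisField p s, b ≠ 0 →
      (Q b = 0 →
        ∑ x ∈ Finset.univ.filter fun x => Q x = 0, psi p s (polarForm Q b x)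
          = (ε : ℂ) * ((p : ℂ) ^ s) ^ (m - 1) * ((p : ℂ) ^ s - 1)) ∧
      (Q b ≠ 0 →
        ∑ x ∈ Finset.univ.filter fun x => Q x = 0, psi p s (polarForm Q b x)
          = -(ε : ℂ) * ((p : ℂ) ^ s) ^ (m - 1)) := by
  intro b hb
  have hcard : (Fintype.card (GaloisField p s) : ℂ) = (p : ℂ) ^ s := by
    rw [← Nat.card_eq_fintype_card, GaloisField.card p s hs.ne', Nat.cast_pow]
  have hq : (p : ℂ) ^ s ≠ 0 :=
    pow_ne_zero _ (Nat.cast_ne_zero.mpr (Fact.out : p.Prime).ne_zero)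
  have hb' : ∃ y, polarForm Q b y ≠ 0 := by
    by_contra! h
    exact hb (hBnd b h)
  simp only [← psiAddChar_apply] at hsum ⊢
  have key := card_mul_sum_quadric (psiAddChar_isPrimitive p s) hQ hBadd hBsmul hsum hb'
  obtain ⟨k, rfl⟩ := Nat.exists_eq_add_of_le' hm
  rw [hcard, pow_succ] at key
  rw [Nat.add_sub_cancel]
  refine ⟨fun h => mul_left_cancel₀ hq ?_, fun h => mul_left_cancel₀ hq ?_⟩
  · rw [if_pos h] at key
    linear_combination key
  · rw [if_neg h] at key
    linear_combination key
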